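/- For m + n ≥ 2, the non-abelian tensor square of the Heisenberg Lie superalgebra H(m, n) satisfies dim(H(m, n) ⊗ H(m, n)) = (4m² + n² | 4mn), so its total dimension is 4m² + 4mn + n² = (2m + n)². Moreover, dim(H(m, n) □ H(m, n)) = (2m² + m + n(n−1)/2 | 2mn). -/

import Mathlib

open Module Function TensorProduct

universe u v w x y z

/-- The sign `(-1)^(ab)` for degrees `a b : ZMod 2`, as an element of the field `F`. -/
def sgn (F : Type u) [Field F] (a b : ZMod 2) : F :=
  if a = 1 ∧ b = 1 then -1 else 1

/-- A supermodule (ℤ/2-graded vector space) over `F`. -/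
class SuperModule (F : Type u) (V : Type v) [Field F] [AddCommGroup V] [Module F V] where
  grade : ZMod 2 → Submodule F V
  isCompl_grade : IsCompl (grade 0) (grade 1)

/-- The graded piece of degree `a`. -/
abbrev gr (F : Type u) (V : Type v) [Field F] [AddCommGroup V] [Module F V]
    [s : SuperModule F V] (a : ZMod 2) : Submodule F V := s.grade a

/-- A Lie superalgebra structure on a supermodule. -/
class LieSuperAlgebra (F : Type u) (L : Type v) [Field F] [AddCommGroup L] [Module F L]
    [SuperModule F L] where
  bracket : L →ₗ[F] L →ₗ[F] L
  bracket_grade : ∀ (a b : ZMod 2) (x y : L), x ∈ gr F L a → y ∈ gr F L b →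
    bracket x y ∈ gr F L (a + b)
  skew : ∀ (a b : ZMod 2) (x y : L), x ∈ gr F L a → y ∈ gr F L b →
    bracket x y = -(sgn F a b) • bracket y x
  jacobi : ∀ (a b c : ZMod 2) (x y zz : L), x ∈ gr F L a → y ∈ gr F L b → zz ∈ gr F L c →
    sgn F a c • bracket x (bracket y zz) + sgn F b a • bracket y (bracket zz x)
      + sgn F c b • bracket zz (bracket x y) = 0

/-- The bracket of a Lie superalgebra. -/
abbrev br (F : Type u) (L : Type v) [Field F] [AddCommGroup L] [Module F L] [SuperModule F L]
    [s : LieSuperAlgebra F L] : L →ₗ[F] L →ₗ[F] L := s.bracket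

/-- A graded submodule. -/
def IsGradedSub (F : Type u) {V : Type v} [Field F] [AddCommGroup V] [Module F V]
    [SuperModule F V] (N : Submodule F V) : Prop :=
  N ≤ (N ⊓ gr F V 0) ⊔ (N ⊓ gr F V 1)

section LSADefs

variable (F : Type u) [Field F]
variable (L : Type v) [AddCommGroup L] [Module F L] [SuperModule F L] [LieSuperAlgebra F L]

/-- The derived subalgebra `L² = [L, L]`. -/
def derivedSub : Submodule F L := Submodule.span F {t | ∃ x y : L, br F L x y = t}

/-- The center `Z(L)`. -/
def centerSub : Submodule F L := ⨅ x : L, LinearMap.ker ((br F L).flip x)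

/-- The span of brackets `[A, B]` of two submodules. -/
def bracketSub (A B : Submodule F L) : Submodule F L :=
  Submodule.span F {t | ∃ x ∈ A, ∃ y ∈ B, br F L x y = t}

/-- Abelian Lie superalgebra. -/
def IsAbelianLSA : Prop := ∀ x y : L, br F L x y = 0

/-- The lower central series. -/
def lcs : ℕ → Submodule F L
  | 0 => ⊤
  | n + 1 => Submodule.span F {t | ∃ x : L, ∃ y ∈ lcs n, br F L x y = t}

/-- Nilpotent Lie superalgebra. -/
def IsNilpotentLSA : Prop := ∃ n : ℕ, lcs F L n = ⊥

end LSADefs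

/-- Homomorphism of Lie superalgebras: an even linear map preserving grading and bracket. -/
structure LieSuperHom (F : Type u) (L : Type v) (M : Type w) [Field F]
    [AddCommGroup L] [Module F L] [SuperModule F L] [LieSuperAlgebra F L]
    [AddCommGroup M] [Module F M] [SuperModule F M] [LieSuperAlgebra F M]
    extends L →ₗ[F] M where
  map_grade : ∀ (a : ZMod 2) (x : L), x ∈ gr F L a → toLinearMap x ∈ gr F M a
  map_bracket : ∀ x y : L, toLinearMap (br F L x y) = br F M (toLinearMap x) (toLinearMap y)

/-- Isomorphism of Lie superalgebras. -/
def LSAIsomorphic (F : Type u) (L : Type v) (M : Type w) [Field F]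
    [AddCommGroup L] [Module F L] [SuperModule F L] [LieSuperAlgebra F L]
    [AddCommGroup M] [Module F M] [SuperModule F M] [LieSuperAlgebra F M] : Prop :=
  ∃ f : LieSuperHom F L M, Function.Bijective f.toLinearMap

/-- `Q` is (a realization of) the quotient `L / L²`, i.e. the abelianization of `L`. -/
def IsQuotientByDerived (F : Type u) (L : Type v) (Q : Type w) [Field F]
    [AddCommGroup L] [Module F L] [SuperModule F L] [LieSuperAlgebra F L]
    [AddCommGroup Q] [Module F Q] [SuperModule F Q] [LieSuperAlgebra F Q] : Prop :=
  ∃ f : LieSuperHom F L Q, Function.Surjective f.toLinearMap ∧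
    LinearMap.ker f.toLinearMap = derivedSub F L

/-- An action of the Lie superalgebra `P` on the Lie superalgebra `M`. -/
structure LieSuperAction (F : Type u) (P : Type v) (M : Type w) [Field F]
    [AddCommGroup P] [Module F P] [SuperModule F P] [LieSuperAlgebra F P]
    [AddCommGroup M] [Module F M] [SuperModule F M] [LieSuperAlgebra F M] where
  act : P →ₗ[F] M →ₗ[F] M
  act_grade : ∀ (a b : ZMod 2) (p : P) (m : M), p ∈ gr F P a → m ∈ gr F M b →
    act p m ∈ gr F M (a + b)
  act_bracket : ∀ (a b : ZMod 2) (p p' : P) (m : M), p ∈ gr F P a → p' ∈ gr F P b →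
    act (br F P p p') m = act p (act p' m) - sgn F a b • act p' (act p m)
  act_lie : ∀ (a b : ZMod 2) (p : P) (m m' : M), p ∈ gr F P a → m ∈ gr F M b →
    act p (br F M m m') = br F M (act p m) m' + sgn F a b • br F M m (act p m')

/-- A trivial action. -/
def LieSuperAction.IsTrivial {F : Type u} {P : Type v} {M : Type w} [Field F]
    [AddCommGroup P] [Module F P] [SuperModule F P] [LieSuperAlgebra F P]
    [AddCommGroup M] [Module F M] [SuperModule F M] [LieSuperAlgebra F M]
    (α : LieSuperAction F P M) : Prop := ∀ (p : P) (m : M), α.act p m = 0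

/-- The trivial action of `P` on `M`. -/
def trivialAction (F : Type u) (P : Type v) (M : Type w) [Field F]
    [AddCommGroup P] [Module F P] [SuperModule F P] [LieSuperAlgebra F P]
    [AddCommGroup M] [Module F M] [SuperModule F M] [LieSuperAlgebra F M] :
    LieSuperAction F P M where
  act := 0
  act_grade := by
    intro a b p m _ _
    simp only [LinearMap.zero_apply]
    exact (gr F M (a + b)).zero_mem
  act_bracket := by intro a b p p' m _ _; simp
  act_lie := by intro a b p m m' _ _; simp

/-- A Lie superpairing on `M × N` (relative to mutual actions) with values in the
Lie superalgebra `T`; these are exactly the defining relations of the non-abelian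
tensor product `M ⊗ N`. -/
structure SuperPairing (F : Type u) (M : Type v) (N : Type w) (T : Type x) [Field F]
    [AddCommGroup M] [Module F M] [SuperModule F M] [LieSuperAlgebra F M]
    [AddCommGroup N] [Module F N] [SuperModule F N] [LieSuperAlgebra F N]
    [AddCommGroup T] [Module F T] [SuperModule F T] [LieSuperAlgebra F T]
    (α : LieSuperAction F M N) (β : LieSuperAction F N M) where
  pair : M →ₗ[F] N →ₗ[F] T
  pair_grade : ∀ (a b : ZMod 2) (m : M) (n : N), m ∈ gr F M a → n ∈ gr F N b →
    pair m n ∈ gr F T (a + b)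
  rel1 : ∀ (a b : ZMod 2) (m m' : M) (n : N), m ∈ gr F M a → m' ∈ gr F M b →
    pair (br F M m m') n = pair m (α.act m' n) - sgn F a b • pair m' (α.act m n)
  rel2 : ∀ (a b c : ZMod 2) (m : M) (n n' : N), m ∈ gr F M a → n ∈ gr F N b → n' ∈ gr F N c →
    pair m (br F N n n') = sgn F c (a + b) • pair (β.act n' m) n - sgn F a b • pair (β.act n m) n'
  rel3 : ∀ (a b : ZMod 2) (m : M) (n : N) (m' : M) (n' : N), m ∈ gr F M a → n ∈ gr F N b →
    br F T (pair m n) (pair m' n') = - sgn F a b • pair (β.act n m) (α.act m' n')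

/-- `T`, together with the pairing `p`, is (a realization of) the non-abelian tensor
product `M ⊗ N`: it satisfies the universal property among Lie superpairings. -/
def IsTensorProductLSA (F : Type u) (M : Type v) (N : Type w) (T : Type x) [Field F]
    [AddCommGroup M] [Module F M] [SuperModule F M] [LieSuperAlgebra F M]
    [AddCommGroup N] [Module F N] [SuperModule F N] [LieSuperAlgebra F N]
    [AddCommGroup T] [Module F T] [SuperModule F T] [LieSuperAlgebra F T]
    (α : LieSuperAction F M N) (β : LieSuperAction F N M)
    (p : SuperPairing F M N T α β) : Prop :=
  ∀ (T' : Type (max u v w x)) [AddCommGroup T'] [Module F T'] [SuperModule F T']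
    [LieSuperAlgebra F T'] (q : SuperPairing F M N T' α β),
    ∃! h : LieSuperHom F T T', ∀ (m : M) (n : N), h.toLinearMap (p.pair m n) = q.pair m n

/-- A Lie superpairing for the tensor square `L ⊗ L` (with adjoint actions):
the defining relations of the non-abelian tensor square. -/
structure TensorSqPairing (F : Type u) (L : Type v) (T : Type w) [Field F]
    [AddCommGroup L] [Module F L] [SuperModule F L] [LieSuperAlgebra F L]
    [AddCommGroup T] [Module F T] [SuperModule F T] [LieSuperAlgebra F T] where
  pair : L →ₗ[F] L →ₗ[F] T
  pair_grade : ∀ (a b : ZMod 2) (x y : L), x ∈ gr F L a → y ∈ gr F L b →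
    pair x y ∈ gr F T (a + b)
  rel1 : ∀ (a b : ZMod 2) (x x' y : L), x ∈ gr F L a → x' ∈ gr F L b →
    pair (br F L x x') y = pair x (br F L x' y) - sgn F a b • pair x' (br F L x y)
  rel2 : ∀ (a b c : ZMod 2) (x y y' : L), x ∈ gr F L a → y ∈ gr F L b → y' ∈ gr F L c →
    pair x (br F L y y') = sgn F c (a + b) • pair (br F L y' x) y
      - sgn F a b • pair (br F L y x) y'
  rel3 : ∀ (a b : ZMod 2) (x y x' y' : L), x ∈ gr F L a → y ∈ gr F L b →
    br F T (pair x y) (pair x' y') = - sgn F a b • pair (br F L y x) (br F L x' y')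

/-- `T`, together with the pairing `p`, is (a realization of) the non-abelian tensor
square `L ⊗ L`. -/
def IsTensorSquare (F : Type u) (L : Type v) (T : Type w) [Field F]
    [AddCommGroup L] [Module F L] [SuperModule F L] [LieSuperAlgebra F L]
    [AddCommGroup T] [Module F T] [SuperModule F T] [LieSuperAlgebra F T]
    (p : TensorSqPairing F L T) : Prop :=
  ∀ (T' : Type (max u v w)) [AddCommGroup T'] [Module F T'] [SuperModule F T']
    [LieSuperAlgebra F T'] (q : TensorSqPairing F L T'),
    ∃! h : LieSuperHom F T T', ∀ x y : L, h.toLinearMap (p.pair x y) = q.pair x y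

/-- The submodule `L □ L` of a realization `T` of `L ⊗ L`, generated by the elements
`x ⊗ x' + (-1)^{|x||x'|} (x' ⊗ x)` (homogeneous `x, x'`) and `x₀ ⊗ x₀` (`x₀` even). -/
def squareBox (F : Type u) (L : Type v) (T : Type w) [Field F]
    [AddCommGroup L] [Module F L] [SuperModule F L] [LieSuperAlgebra F L]
    [AddCommGroup T] [Module F T] [SuperModule F T] [LieSuperAlgebra F T]
    (p : TensorSqPairing F L T) : Submodule F T :=
  Submodule.span F
    ({t | ∃ (a b : ZMod 2) (x y : L), x ∈ gr F L a ∧ y ∈ gr F L b ∧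
        t = p.pair x y + sgn F a b • p.pair y x} ∪
      {t | ∃ x ∈ gr F L 0, t = p.pair x x})

/-- Data of a "universal quadratic functor" target: maps satisfying the defining
relations of `Γ(V)`. -/
structure GammaData (F : Type u) (V : Type v) (W : Type w) [Field F]
    [AddCommGroup V] [Module F V] [SuperModule F V] [AddCommGroup W] [Module F W] where
  gam : V → W
  bil : V →ₗ[F] V →ₗ[F] W
  gam_smul : ∀ (c : F) (v : V), v ∈ gr F V 0 → gam (c • v) = (c * c) • gam v
  gam_add : ∀ v w' : V, v ∈ gr F V 0 → w' ∈ gr F V 0 →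
    gam (v + w') - gam v - gam w' = bil v w'
  bil_symm : ∀ (a b : ZMod 2) (v w' : V), v ∈ gr F V a → w' ∈ gr F V b →
    bil v w' = sgn F a b • bil w' v
  bil_alt : ∀ v : V, v ∈ gr F V 1 → bil v v = 0

/-- `W`, with data `d`, is (a realization of) the universal quadratic functor `Γ(V)`. -/
def IsGamma (F : Type u) (V : Type v) (W : Type w) [Field F]
    [AddCommGroup V] [Module F V] [SuperModule F V] [AddCommGroup W] [Module F W]
    (d : GammaData F V W) : Prop :=
  ∀ (W' : Type (max u v w)) [AddCommGroup W'] [Module F W'] (d' : GammaData F V W'),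
    ∃! h : W →ₗ[F] W',
      (∀ v ∈ gr F V 0, h (d.gam v) = d'.gam v) ∧ (∀ v w' : V, h (d.bil v w') = d'.bil v w')

/-- `Fr` is a free Lie superalgebra on the graded set `(X, deg)` with inclusion `ι`. -/
def IsFreeLSA (F : Type u) (X : Type v) (deg : X → ZMod 2) (Fr : Type w) [Field F]
    [AddCommGroup Fr] [Module F Fr] [SuperModule F Fr] [LieSuperAlgebra F Fr]
    (ι : X → Fr) : Prop :=
  (∀ x : X, ι x ∈ gr F Fr (deg x)) ∧
  ∀ (K : Type (max u v w)) [AddCommGroup K] [Module F K] [SuperModule F K]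
    [LieSuperAlgebra F K] (f : X → K), (∀ x : X, f x ∈ gr F K (deg x)) →
    ∃! h : LieSuperHom F Fr K, ∀ x : X, h.toLinearMap (ι x) = f x

/-- Dimension of the degree-`a` part of the Schur multiplier `(R ∩ [Fr,Fr])/[Fr,R]`
attached to a free presentation with kernel `R`. -/
noncomputable def schurDim (F : Type u) (Fr : Type v) [Field F] [AddCommGroup Fr]
    [Module F Fr] [SuperModule F Fr] [LieSuperAlgebra F Fr]
    (R : Submodule F Fr) (a : ZMod 2) : ℕ :=
  finrank F ((R ⊓ derivedSub F Fr ⊓ gr F Fr a).map (bracketSub F Fr ⊤ R).mkQ)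

/-- `L` is (isomorphic to) the Heisenberg Lie superalgebra `H(m, n)` with even center:
it admits a homogeneous basis `x₁,…,x_{2m}, y₁,…,y_n, z` with the defining brackets. -/
def IsHmn (F : Type u) (m n : ℕ) (L : Type v) [Field F]
    [AddCommGroup L] [Module F L] [SuperModule F L] [LieSuperAlgebra F L] : Prop :=
  ∃ (xv : Fin (2 * m) → L) (yv : Fin n → L) (zv : L)
    (B : Basis ((Fin (2 * m)) ⊕ (Fin n) ⊕ Unit) F L),
    (∀ i, B (Sum.inl i) = xv i) ∧ (∀ j, B (Sum.inr (Sum.inl j)) = yv j) ∧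
    B (Sum.inr (Sum.inr ())) = zv ∧
    (∀ i, xv i ∈ gr F L 0) ∧ (∀ j, yv j ∈ gr F L 1) ∧ zv ∈ gr F L 0 ∧
    (∀ i j : Fin (2 * m), br F L (xv i) (xv j) =
      if (j : ℕ) = (i : ℕ) + m then zv else if (i : ℕ) = (j : ℕ) + m then -zv else 0) ∧
    (∀ (i : Fin (2 * m)) (j : Fin n), br F L (xv i) (yv j) = 0) ∧
    (∀ (j : Fin n) (i : Fin (2 * m)), br F L (yv j) (xv i) = 0) ∧
    (∀ j k : Fin n, br F L (yv j) (yv k) = if j = k then zv else 0) ∧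
    (∀ i, br F L (xv i) zv = 0) ∧ (∀ i, br F L zv (xv i) = 0) ∧
    (∀ j, br F L (yv j) zv = 0) ∧ (∀ j, br F L zv (yv j) = 0) ∧
    br F L zv zv = 0

/-- `L` is (isomorphic to) the Heisenberg Lie superalgebra `H_m` with odd center. -/
def IsHmOdd (F : Type u) (m : ℕ) (L : Type v) [Field F]
    [AddCommGroup L] [Module F L] [SuperModule F L] [LieSuperAlgebra F L] : Prop :=
  ∃ (xv yv : Fin m → L) (zv : L) (B : Basis ((Fin m) ⊕ (Fin m) ⊕ Unit) F L),
    (∀ i, B (Sum.inl i) = xv i) ∧ (∀ j, B (Sum.inr (Sum.inl j)) = yv j) ∧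
    B (Sum.inr (Sum.inr ())) = zv ∧
    (∀ i, xv i ∈ gr F L 0) ∧ (∀ j, yv j ∈ gr F L 1) ∧ zv ∈ gr F L 1 ∧
    (∀ i j, br F L (xv i) (xv j) = 0) ∧
    (∀ i j, br F L (xv i) (yv j) = if i = j then zv else 0) ∧
    (∀ i j, br F L (yv i) (xv j) = if i = j then -zv else 0) ∧
    (∀ i j, br F L (yv i) (yv j) = 0) ∧
    (∀ i, br F L (xv i) zv = 0) ∧ (∀ i, br F L zv (xv i) = 0) ∧
    (∀ j, br F L (yv j) zv = 0) ∧ (∀ j, br F L zv (yv j) = 0) ∧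
    br F L zv zv = 0

/-- `A` is (isomorphic to) the abelian Lie superalgebra `A(a | b)`. -/
def IsAbelianOfDim (F : Type u) (a b : ℕ) (A : Type v) [Field F]
    [AddCommGroup A] [Module F A] [SuperModule F A] [LieSuperAlgebra F A] : Prop :=
  IsAbelianLSA F A ∧ finrank F (gr F A 0) = a ∧ finrank F (gr F A 1) = b

/-- Heisenberg Lie superalgebra with even center: `Z(L) = L²` is one-dimensional,
spanned by a nonzero even element. -/
def IsHeisenbergEven (F : Type u) (L : Type v) [Field F]
    [AddCommGroup L] [Module F L] [SuperModule F L] [LieSuperAlgebra F L] : Prop :=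
  centerSub F L = derivedSub F L ∧
  ∃ zc : L, zc ≠ 0 ∧ zc ∈ gr F L 0 ∧ centerSub F L = Submodule.span F {zc}

/-- Heisenberg Lie superalgebra with odd center. -/
def IsHeisenbergOdd (F : Type u) (L : Type v) [Field F]
    [AddCommGroup L] [Module F L] [SuperModule F L] [LieSuperAlgebra F L] : Prop :=
  centerSub F L = derivedSub F L ∧
  ∃ zc : L, zc ≠ 0 ∧ zc ∈ gr F L 1 ∧ centerSub F L = Submodule.span F {zc}

/-- `P ≅ L ⊕ M` as Lie superalgebras (internal direct sum of two commuting copies). -/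
def IsDirectSumOf (F : Type u) (P : Type v) (L : Type w) (M : Type x) [Field F]
    [AddCommGroup P] [Module F P] [SuperModule F P] [LieSuperAlgebra F P]
    [AddCommGroup L] [Module F L] [SuperModule F L] [LieSuperAlgebra F L]
    [AddCommGroup M] [Module F M] [SuperModule F M] [LieSuperAlgebra F M] : Prop :=
  ∃ (f : LieSuperHom F L P) (g : LieSuperHom F M P),
    Function.Bijective (fun q : L × M => f.toLinearMap q.1 + g.toLinearMap q.2) ∧
    (∀ (x : L) (y : M), br F P (f.toLinearMap x) (g.toLinearMap y) = 0) ∧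
    (∀ (y : M) (x : L), br F P (g.toLinearMap y) (f.toLinearMap x) = 0)

/-- `S ≅ A ⊕ B ⊕ C ⊕ D` as Lie superalgebras. -/
def IsDirectSumOf4 (F : Type u) (S : Type v) (A : Type w) (B : Type x) (C : Type y)
    (D : Type z) [Field F]
    [AddCommGroup S] [Module F S] [SuperModule F S] [LieSuperAlgebra F S]
    [AddCommGroup A] [Module F A] [SuperModule F A] [LieSuperAlgebra F A]
    [AddCommGroup B] [Module F B] [SuperModule F B] [LieSuperAlgebra F B]
    [AddCommGroup C] [Module F C] [SuperModule F C] [LieSuperAlgebra F C]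
    [AddCommGroup D] [Module F D] [SuperModule F D] [LieSuperAlgebra F D] : Prop :=
  ∃ (f : LieSuperHom F A S) (g : LieSuperHom F B S) (h : LieSuperHom F C S)
    (k : LieSuperHom F D S),
    Function.Bijective (fun q : A × B × C × D =>
      f.toLinearMap q.1 + g.toLinearMap q.2.1 + h.toLinearMap q.2.2.1
        + k.toLinearMap q.2.2.2) ∧
    (∀ u v', br F S (f.toLinearMap u) (g.toLinearMap v') = 0) ∧
    (∀ u v', br F S (f.toLinearMap u) (h.toLinearMap v') = 0) ∧
    (∀ u v', br F S (f.toLinearMap u) (k.toLinearMap v') = 0) ∧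
    (∀ u v', br F S (g.toLinearMap u) (h.toLinearMap v') = 0) ∧
    (∀ u v', br F S (g.toLinearMap u) (k.toLinearMap v') = 0) ∧
    (∀ u v', br F S (h.toLinearMap u) (k.toLinearMap v') = 0)

/-- `L ≅ H(m, n) ⊕ A(a | b)`: an internal decomposition into a Heisenberg part with
even center, spanned by homogeneous elements with the defining brackets, and a central
abelian graded complement of dimension `(a | b)`. -/
def DecompHeisenbergAbelian (F : Type u) (L : Type v) [Field F]
    [AddCommGroup L] [Module F L] [SuperModule F L] [LieSuperAlgebra F L]
    (m n a b : ℕ) : Prop :=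
  ∃ (xv : Fin (2 * m) → L) (yv : Fin n → L) (zv : L) (A : Submodule F L),
    (∀ i, xv i ∈ gr F L 0) ∧ (∀ j, yv j ∈ gr F L 1) ∧ zv ∈ gr F L 0 ∧
    IsGradedSub F A ∧
    finrank F (A ⊓ gr F L 0 : Submodule F L) = a ∧
    finrank F (A ⊓ gr F L 1 : Submodule F L) = b ∧
    (∀ u ∈ A, ∀ v : L, br F L u v = 0 ∧ br F L v u = 0) ∧
    LinearIndependent F (Sum.elim xv (Sum.elim yv (fun _ : Unit => zv))) ∧
    Disjoint (Submodule.span F (Set.range (Sum.elim xv (Sum.elim yv (fun _ : Unit => zv))))) A ∧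
    Submodule.span F (Set.range (Sum.elim xv (Sum.elim yv (fun _ : Unit => zv)))) ⊔ A = ⊤ ∧
    (∀ i j : Fin (2 * m), br F L (xv i) (xv j) =
      if (j : ℕ) = (i : ℕ) + m then zv else if (i : ℕ) = (j : ℕ) + m then -zv else 0) ∧
    (∀ (i : Fin (2 * m)) (j : Fin n), br F L (xv i) (yv j) = 0) ∧
    (∀ (j : Fin n) (i : Fin (2 * m)), br F L (yv j) (xv i) = 0) ∧
    (∀ j k : Fin n, br F L (yv j) (yv k) = if j = k then zv else 0) ∧
    (∀ i, br F L (xv i) zv = 0) ∧ (∀ i, br F L zv (xv i) = 0) ∧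
    (∀ j, br F L (yv j) zv = 0) ∧ (∀ j, br F L zv (yv j) = 0) ∧
    br F L zv zv = 0

/-- The submodule of a realization of `I ⊗ J` (for graded ideals `I, J` of `M`)
generated by `x ⊗ y + (-1)^(|x||y|) y ⊗ x` and `x₀ ⊗ x₀` for `x, y, x₀ ∈ I ∩ J`,
`x₀` even. -/
def pairBox (F : Type u) (I : Type v) (J : Type w) (TIJ : Type x) (M : Type y) [Field F]
    [AddCommGroup I] [Module F I] [SuperModule F I] [LieSuperAlgebra F I]
    [AddCommGroup J] [Module F J] [SuperModule F J] [LieSuperAlgebra F J]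
    [AddCommGroup TIJ] [Module F TIJ] [SuperModule F TIJ] [LieSuperAlgebra F TIJ]
    [AddCommGroup M] [Module F M] [SuperModule F M] [LieSuperAlgebra F M]
    (ι : LieSuperHom F I M) (κ : LieSuperHom F J M)
    (α : LieSuperAction F I J) (β : LieSuperAction F J I)
    (p : SuperPairing F I J TIJ α β) : Submodule F TIJ :=
  Submodule.span F
    ({t | ∃ (a b : ZMod 2) (i i' : I) (j j' : J),
        ι.toLinearMap i = κ.toLinearMap j ∧ ι.toLinearMap i' = κ.toLinearMap j' ∧
        ι.toLinearMap i ∈ gr F M a ∧ ι.toLinearMap i' ∈ gr F M b ∧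
        t = p.pair i j' + sgn F a b • p.pair i' j} ∪
      {t | ∃ (i : I) (j : J), ι.toLinearMap i = κ.toLinearMap j ∧
        ι.toLinearMap i ∈ gr F M 0 ∧ t = p.pair i j})

theorem sh_zmod2 (a : ZMod 2) : a = 0 ∨ a = 1 := by revert a; decide

theorem sh_ne : ∀ a e : ZMod 2, e ≠ a → e = a + 1 := by decide

instance shULiftSuper (F : Type u) (V : Type v) [Field F] [AddCommGroup V] [Module F V]
    [SuperModule F V] : SuperModule F (ULift.{w} V) where
  grade a := (gr F V a).comap (ULift.moduleEquiv (R := F) (M := V)).toLinearMap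
  isCompl_grade := by
    have h := SuperModule.isCompl_grade (F := F) (V := V)
    exact (Submodule.orderIsoMapComap (ULift.moduleEquiv (R := F) (M := V)).symm).isCompl_iff.1 h |>
      fun h => by
        simpa [Submodule.orderIsoMapComap, Submodule.map_equiv_eq_comap_symm] using h

theorem sh_mem_ulift (F : Type u) (V : Type v) [Field F] [AddCommGroup V] [Module F V]
    [SuperModule F V] (a : ZMod 2) (x : ULift.{w} V) :
    x ∈ gr F (ULift.{w} V) a ↔ x.down ∈ gr F V a := Iff.rfl

instance shULiftLie (F : Type u) (V : Type v) [Field F] [AddCommGroup V] [Module F V]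
    [SuperModule F V] [LieSuperAlgebra F V] : LieSuperAlgebra F (ULift.{w} V) where
  bracket := LinearMap.mk₂ F (fun x y => ULift.up (br F V x.down y.down))
    (by intros; ext; simp) (by intros; ext; simp) (by intros; ext; simp) (by intros; ext; simp)
  bracket_grade := by
    intro a b x y hx hy
    exact LieSuperAlgebra.bracket_grade a b x.down y.down hx hy
  skew := by
    intro a b x y hx hy
    apply ULift.ext
    simpa using LieSuperAlgebra.skew a b x.down y.down hx hy
  jacobi := by
    intro a b c x y z hx hy hz
    apply ULift.ext
    simpa using LieSuperAlgebra.jacobi a b c x.down y.down z.down hx hy hz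

theorem sh_br_ulift (F : Type u) (V : Type v) [Field F] [AddCommGroup V] [Module F V]
    [SuperModule F V] [LieSuperAlgebra F V] (x y : ULift.{w} V) :
    br F (ULift.{w} V) x y = ULift.up (br F V x.down y.down) := rfl

/-- lift a pairing -/
def shLiftPair {F : Type u} {L : Type v} {T : Type w} [Field F]
    [AddCommGroup L] [Module F L] [SuperModule F L] [LieSuperAlgebra F L]
    [AddCommGroup T] [Module F T] [SuperModule F T] [LieSuperAlgebra F T]
    (p : TensorSqPairing F L T) : TensorSqPairing F L (ULift.{x} T) where
  pair := p.pair.compr₂ (ULift.moduleEquiv (R := F) (M := T)).symm.toLinearMap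
  pair_grade := by
    intro a b x y hx hy
    exact p.pair_grade a b x y hx hy
  rel1 := by
    intro a b x x' y hx hx'
    apply ULift.ext
    simpa using p.rel1 a b x x' y hx hx'
  rel2 := by
    intro a b c x y y' hx hy hy'
    apply ULift.ext
    simpa using p.rel2 a b c x y y' hx hy hy'
  rel3 := by
    intro a b x y x' y' hx hy
    apply ULift.ext
    simpa [sh_br_ulift] using p.rel3 a b x y x' y' hx hy

/-- index type -/
abbrev ShI (m n : ℕ) := Fin (2 * m) ⊕ Fin n

/-- degree -/
def shDeg (m n : ℕ) : ShI m n → ZMod 2 := Sum.elim (fun _ => 0) (fun _ => 1)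

/-- model -/
abbrev ShM (F : Type u) (m n : ℕ) := ShI m n × ShI m n → F

instance shMSuper (F : Type u) [Field F] (m n : ℕ) : SuperModule F (ShM F m n) where
  grade a :=
    { carrier := {f | ∀ i j, shDeg m n i + shDeg m n j ≠ a → f (i, j) = 0}
      add_mem' := by
        intro f g hf hg i j h
        simp [hf i j h, hg i j h]
      zero_mem' := by intro i j _; rfl
      smul_mem' := by
        intro c f hf i j h
        simp [hf i j h] }
  isCompl_grade := by
    constructor
    · rw [Submodule.disjoint_def]
      intro f h0 h1
      ext ⟨i, j⟩
      by_cases h : shDeg m n i + shDeg m n j = 0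
      · exact h1 i j (by rw [h]; decide)
      · exact h0 i j h
    · rw [codisjoint_iff, eq_top_iff]
      intro f _
      rw [Submodule.mem_sup]
      refine ⟨fun ij => if shDeg m n ij.1 + shDeg m n ij.2 = 0 then f ij else 0, ?_,
        fun ij => if shDeg m n ij.1 + shDeg m n ij.2 = 0 then 0 else f ij, ?_, ?_⟩
      · intro i j h
        simp [h]
      · intro i j h
        rcases sh_zmod2 (shDeg m n i + shDeg m n j) with h' | h'
        · simp [h']
        · exact absurd h' h
      · ext ij
        by_cases h : shDeg m n ij.1 + shDeg m n ij.2 = 0 <;> simp [h]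

theorem sh_mem_M (F : Type u) [Field F] (m n : ℕ) (a : ZMod 2) (f : ShM F m n) :
    f ∈ gr F (ShM F m n) a ↔ ∀ i j, shDeg m n i + shDeg m n j ≠ a → f (i, j) = 0 := Iff.rfl

instance shMLie (F : Type u) [Field F] (m n : ℕ) : LieSuperAlgebra F (ShM F m n) where
  bracket := 0
  bracket_grade := by intros; simp
  skew := by intros; simp
  jacobi := by intros; simp

theorem sh_br_M (F : Type u) [Field F] (m n : ℕ) (f g : ShM F m n) :
    br F (ShM F m n) f g = 0 := rfl

theorem sh_finrank {F : Type u} [Field F] {ι : Type v} {κ : Type w} [Fintype κ]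
    (W : Submodule F (ι → F)) (ρ : κ → ι)
    (hinj : ∀ f ∈ W, (∀ k, f (ρ k) = 0) → f = 0)
    (hsurj : ∀ g : κ → F, ∃ f ∈ W, ∀ k, f (ρ k) = g k) : finrank F W = Fintype.card κ := by
  have hb : Function.Bijective ((LinearMap.funLeft F F ρ).comp W.subtype) := by
    constructor
    · rw [injective_iff_map_eq_zero]
      intro f hf
      apply Subtype.ext
      exact hinj f.1 f.2 (fun k => congrFun hf k)
    · intro g
      obtain ⟨f, hf, h⟩ := hsurj g
      exact ⟨⟨f, hf⟩, funext h⟩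
  exact (LinearEquiv.ofBijective _ hb).finrank_eq.trans (Module.finrank_fintype_fun_eq_card F)

theorem sh_rank0 (F : Type u) [Field F] (m n : ℕ) :
    finrank F (gr F (ShM F m n) 0) = 4 * m ^ 2 + n ^ 2 := by
  rw [sh_finrank (κ := (Fin (2 * m) × Fin (2 * m)) ⊕ (Fin n × Fin n)) (gr F (ShM F m n) 0)
    (Sum.elim (fun q => (Sum.inl q.1, Sum.inl q.2)) (fun q => (Sum.inr q.1, Sum.inr q.2)))]
  · simp; ring
  · intro f hf h
    ext ⟨i | i, j | j⟩
    · exact h (Sum.inl (i, j))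
    · exact hf _ _ (by simp [shDeg])
    · exact hf _ _ (by simp [shDeg])
    · exact h (Sum.inr (i, j))
  · intro g
    refine ⟨fun ij => match ij with
      | (Sum.inl i, Sum.inl j) => g (Sum.inl (i, j))
      | (Sum.inr i, Sum.inr j) => g (Sum.inr (i, j))
      | _ => 0, ?_, ?_⟩
    · rintro (i | i) (j | j) h <;> first | rfl | exact absurd (by simp [shDeg]; try decide) h
    · rintro (k | k) <;> rfl

theorem sh_rank1 (F : Type u) [Field F] (m n : ℕ) :
    finrank F (gr F (ShM F m n) 1) = 4 * m * n := by
  rw [sh_finrank (κ := (Fin (2 * m) × Fin n) ⊕ (Fin n × Fin (2 * m))) (gr F (ShM F m n) 1)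
    (Sum.elim (fun q => (Sum.inl q.1, Sum.inr q.2)) (fun q => (Sum.inr q.1, Sum.inl q.2)))]
  · simp; ring
  · intro f hf h
    ext ⟨i | i, j | j⟩
    · exact hf _ _ (by simp [shDeg])
    · exact h (Sum.inl (i, j))
    · exact h (Sum.inr (i, j))
    · exact hf _ _ (by simp [shDeg]; try decide)
  · intro g
    refine ⟨fun ij => match ij with
      | (Sum.inl i, Sum.inr j) => g (Sum.inl (i, j))
      | (Sum.inr i, Sum.inl j) => g (Sum.inr (i, j))
      | _ => 0, ?_, ?_⟩
    · rintro (i | i) (j | j) h <;> first | rfl | exact absurd (by simp [shDeg]) h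
    · rintro (k | k) <;> rfl

/-- super-symmetric elements -/
def shSS (F : Type u) [Field F] (m n : ℕ) : Submodule F (ShM F m n) where
  carrier := {f | ∀ i j, f (i, j) = sgn F (shDeg m n i) (shDeg m n j) * f (j, i)}
  add_mem' := by
    intro f g hf hg i j
    simp only [Pi.add_apply, hf i j, hg i j]
    ring
  zero_mem' := by intro i j; simp
  smul_mem' := by
    intro c f hf i j
    simp only [Pi.smul_apply, smul_eq_mul, hf i j]
    ring

theorem sh_card_lt (k : ℕ) : Fintype.card {q : Fin k × Fin k // q.1 < q.2} = k * (k - 1) / 2 := by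
  have h1 : Fintype.card {q : Fin k × Fin k // q.1 < q.2}
      = Fintype.card {q : Fin k × Fin k // q.2 < q.1} :=
    Fintype.card_congr ((Equiv.prodComm _ _).subtypeEquiv (by intro a; rfl))
  have h2 : Fintype.card {q : Fin k × Fin k // q.1 = q.2} = k := by
    rw [Fintype.card_congr (β := Fin k) ⟨fun q => q.1.1, fun i => ⟨(i, i), rfl⟩,
      by rintro ⟨⟨a, b⟩, h⟩; simp at h; simp [h], fun i => rfl⟩]
    simp
  have h3 : k * k = Fintype.card {q : Fin k × Fin k // q.1 < q.2}
      + Fintype.card {q : Fin k × Fin k // q.1 = q.2}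
      + Fintype.card {q : Fin k × Fin k // q.2 < q.1} := by
    have : k * k = Fintype.card (Fin k × Fin k) := by simp
    rw [this, ← Finset.card_univ]
    simp only [Fintype.card_subtype]
    rw [← Finset.card_union_of_disjoint, ← Finset.card_union_of_disjoint]
    · congr 1
      ext q
      simp
      rcases lt_trichotomy q.1 q.2 with h | h | h <;> simp [h]
    · rw [Finset.disjoint_left]
      simp only [Finset.mem_union, Finset.mem_filter, Finset.mem_univ, true_and]
      intro q h h'
      rcases h with h | h
      · exact absurd h h'.asymm
      · rw [h] at h'; exact absurd h' (lt_irrefl _)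
    · rw [Finset.disjoint_left]
      simp only [Finset.mem_filter, Finset.mem_univ, true_and]
      intro q h h'
      exact absurd h' h.ne
  rw [h2, ← h1] at h3
  have h4 : k * (k - 1) = k * k - k := by rw [Nat.mul_sub, mul_one]
  omega

theorem sh_card_le (m : ℕ) :
    Fintype.card {q : Fin (2 * m) × Fin (2 * m) // q.1 ≤ q.2} = 2 * m ^ 2 + m := by
  have h0 : Fintype.card {q : Fin (2 * m) × Fin (2 * m) // q.2 < q.1} = 2 * m * (2 * m - 1) / 2 := by
    rw [← sh_card_lt]
    exact Fintype.card_congr ((Equiv.prodComm _ _).subtypeEquiv (by intro a; rfl))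
  have h1 := Fintype.card_subtype_compl (fun q : Fin (2 * m) × Fin (2 * m) => q.2 < q.1)
  have h2 : Fintype.card {q : Fin (2 * m) × Fin (2 * m) // q.1 ≤ q.2}
    = Fintype.card {q : Fin (2 * m) × Fin (2 * m) // ¬ q.2 < q.1} :=
    Fintype.card_congr (Equiv.subtypeEquivRight (by intro q; simp))
  rw [h2, h1, h0]
  simp only [Fintype.card_prod, Fintype.card_fin]
  rcases m with _ | m
  · simp
  · have : 2 * (m + 1) * (2 * (m + 1) - 1) / 2 = (m + 1) * (2 * m + 1) := by
      rw [mul_assoc, Nat.mul_div_cancel_left _ (by norm_num)]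
      congr 1
    rw [this]
    apply Nat.sub_eq_of_eq_add
    ring

theorem sh_box0 (F : Type u) [Field F] (h2 : (2 : F) ≠ 0) (m n : ℕ) :
    finrank F (shSS F m n ⊓ gr F (ShM F m n) 0 : Submodule F (ShM F m n))
      = 2 * m ^ 2 + m + n * (n - 1) / 2 := by
  rw [sh_finrank (κ := {q : Fin (2 * m) × Fin (2 * m) // q.1 ≤ q.2} ⊕
      {q : Fin n × Fin n // q.1 < q.2}) _
    (Sum.elim (fun q => (Sum.inl q.1.1, Sum.inl q.1.2)) (fun q => (Sum.inr q.1.1, Sum.inr q.1.2)))]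
  · rw [Fintype.card_sum, sh_card_le, sh_card_lt]
  · rintro f ⟨hs, hf⟩ h
    ext ⟨i | i, j | j⟩
    · rcases le_total i j with hij | hij
      · exact h (Sum.inl ⟨(i, j), hij⟩)
      · rw [hs, show f (Sum.inl j, Sum.inl i) = 0 from h (Sum.inl ⟨(j, i), hij⟩)]
        simp
    · exact hf _ _ (by simp [shDeg])
    · exact hf _ _ (by simp [shDeg])
    · rcases lt_trichotomy i j with hij | hij | hij
      · exact h (Sum.inr ⟨(i, j), hij⟩)
      · subst hij
        have := hs (Sum.inr i) (Sum.inr i)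
        simp [sgn, shDeg] at this
        have h3 : (2 : F) * f (Sum.inr i, Sum.inr i) = 0 := by linear_combination this
        simpa [h2] using h3
      · rw [hs, show f (Sum.inr j, Sum.inr i) = 0 from h (Sum.inr ⟨(j, i), hij⟩)]
        simp
  · intro g
    refine ⟨fun ij => match ij with
      | (Sum.inl i, Sum.inl j) => if h : i ≤ j then g (Sum.inl ⟨(i, j), h⟩) else
          g (Sum.inl ⟨(j, i), le_of_not_ge h⟩)
      | (Sum.inr i, Sum.inr j) => if h : i < j then g (Sum.inr ⟨(i, j), h⟩) else
          if h : j < i then - g (Sum.inr ⟨(j, i), h⟩) else 0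
      | _ => 0, ⟨?_, ?_⟩, ?_⟩
    · rintro (i | i) (j | j)
      · rcases lt_trichotomy i j with h | h | h
        · simp [sgn, shDeg, h.le, h.not_ge]
        · subst h; simp [sgn, shDeg]
        · simp [sgn, shDeg, h.le, h.not_ge]
      · simp
      · simp
      · rcases lt_trichotomy i j with h | h | h
        · simp [sgn, shDeg, h, h.not_gt]
        · subst h; simp [sgn, shDeg]
        · simp [sgn, shDeg, h, h.not_gt]
    · rintro (i | i) (j | j) h <;> first | rfl | exact absurd (by simp [shDeg]; try decide) h
    · rintro (⟨⟨i, j⟩, h⟩ | ⟨⟨i, j⟩, h⟩)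
      · exact dif_pos h
      · exact dif_pos h

theorem sh_box1 (F : Type u) [Field F] (m n : ℕ) :
    finrank F (shSS F m n ⊓ gr F (ShM F m n) 1 : Submodule F (ShM F m n)) = 2 * m * n := by
  rw [sh_finrank (κ := Fin (2 * m) × Fin n) _ (fun q => (Sum.inl q.1, Sum.inr q.2))]
  · simp
  · rintro f ⟨hs, hf⟩ h
    ext ⟨i | i, j | j⟩
    · exact hf _ _ (by simp [shDeg])
    · exact h (i, j)
    · rw [hs, show f (Sum.inl j, Sum.inr i) = 0 from h (j, i)]
      simp
    · exact hf _ _ (by simp [shDeg]; try decide)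
  · intro g
    refine ⟨fun ij => match ij with
      | (Sum.inl i, Sum.inr j) => g (i, j)
      | (Sum.inr i, Sum.inl j) => g (j, i)
      | _ => 0, ⟨?_, ?_⟩, ?_⟩
    · rintro (i | i) (j | j) <;> simp [sgn, shDeg]
    · rintro (i | i) (j | j) h <;> first | rfl | exact absurd (by simp [shDeg]) h
    · rintro k; rfl

/-- embedding of indices -/
def shEmb (m n : ℕ) : ShI m n → Fin (2 * m) ⊕ Fin n ⊕ Unit :=
  Sum.elim Sum.inl (fun j => Sum.inr (Sum.inl j))

/-- model pairing -/
noncomputable def shPair {F : Type u} [Field F] {m n : ℕ} {L : Type v} [AddCommGroup L] [Module F L]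
    (B : Basis ((Fin (2 * m)) ⊕ (Fin n) ⊕ Unit) F L) : L →ₗ[F] L →ₗ[F] ShM F m n :=
  LinearMap.mk₂ F (fun x y ij => B.repr x (shEmb m n ij.1) * B.repr y (shEmb m n ij.2))
    (by intros; ext; simp [add_mul]) (by intros; ext; simp [mul_assoc])
    (by intros; ext; simp [mul_add]) (by intros; ext; simp; ring)

theorem shPair_apply {F : Type u} [Field F] {m n : ℕ} {L : Type v} [AddCommGroup L] [Module F L]
    (B : Basis ((Fin (2 * m)) ⊕ (Fin n) ⊕ Unit) F L) (x y : L) (i j : ShI m n) :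
    shPair B x y (i, j) = B.repr x (shEmb m n i) * B.repr y (shEmb m n j) := rfl

/-- full degree -/
def shDeg' (m n : ℕ) : Fin (2 * m) ⊕ Fin n ⊕ Unit → ZMod 2 :=
  Sum.elim (fun _ => 0) (Sum.elim (fun _ => 1) (fun _ => 0))

theorem shDeg'_emb (m n : ℕ) (i : ShI m n) : shDeg' m n (shEmb m n i) = shDeg m n i := by
  rcases i with i | i <;> rfl

theorem sh_homog {F : Type u} [Field F] {V : Type v} [AddCommGroup V] [Module F V]
    [SuperModule F V] {κ : Type w} [Fintype κ] (B : Basis κ F V) (d : κ → ZMod 2)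
    (hB : ∀ k, B k ∈ gr F V (d k)) (a : ZMod 2) (x : V) (hx : x ∈ gr F V a) (k : κ)
    (hk : d k ≠ a) : B.repr x k = 0 := by
  classical
  have hdis := (SuperModule.isCompl_grade (F := F) (V := V)).disjoint
  have hdis' : ∀ y : V, y ∈ gr F V a → y ∈ gr F V (a + 1) → y = 0 := by
    intro y h1 h2
    rw [Submodule.disjoint_def] at hdis
    rcases sh_zmod2 a with rfl | rfl
    · exact hdis y h1 h2
    · exact hdis y h2 h1
  have hd : ∀ k, d k ≠ a → d k = a + 1 := by
    intro k h; exact sh_ne a (d k) h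
  set y := ∑ k, (if d k = a then 0 else B.repr x k) • B k with hy
  have hy1 : y ∈ gr F V (a + 1) := by
    refine Submodule.sum_mem _ fun k _ => ?_
    split_ifs with h
    · simp
    · rw [← hd k h]; exact Submodule.smul_mem _ _ (hB k)
  have hy2 : y = x - ∑ k, (if d k = a then B.repr x k else 0) • B k := by
    rw [eq_sub_iff_add_eq, hy, ← Finset.sum_add_distrib]
    conv_rhs => rw [← B.sum_repr x]
    refine Finset.sum_congr rfl fun k _ => ?_
    split_ifs <;> simp
  have hy3 : y ∈ gr F V a := by
    rw [hy2]
    refine Submodule.sub_mem _ hx (Submodule.sum_mem _ fun k _ => ?_)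
    split_ifs with h
    · have := hB k
      rw [h] at this
      exact Submodule.smul_mem _ _ this
    · simp
  have h0 := hdis' y hy3 hy1
  have := Fintype.linearIndependent_iff.1 B.linearIndependent _ (hy.symm.trans h0) k
  simpa [hk] using this

theorem sh_sgn_comm (F : Type u) [Field F] (a b : ZMod 2) : sgn F a b = sgn F b a := by
  unfold sgn
  simp only [and_comm]

theorem sh_exists (F : Type u) [Field F] {m n : ℕ} (hmn : 2 ≤ m + n)
    {L : Type v} [AddCommGroup L] [Module F L] [SuperModule F L] [LieSuperAlgebra F L]
    (xv : Fin (2 * m) → L) (yv : Fin n → L) (zv : L)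
    (hx : ∀ i, xv i ∈ gr F L 0) (hy : ∀ j, yv j ∈ gr F L 1)
    (hxx : ∀ i j : Fin (2 * m), br F L (xv i) (xv j) =
      if (j : ℕ) = (i : ℕ) + m then zv else if (i : ℕ) = (j : ℕ) + m then -zv else 0)
    (hxy : ∀ (i : Fin (2 * m)) (j : Fin n), br F L (xv i) (yv j) = 0)
    (hyx : ∀ (j : Fin n) (i : Fin (2 * m)), br F L (yv j) (xv i) = 0)
    (hyy : ∀ j k : Fin n, br F L (yv j) (yv k) = if j = k then zv else 0)
    (hxz : ∀ i, br F L (xv i) zv = 0)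
    (hyz : ∀ j, br F L (yv j) zv = 0)
    (b : L) (hb : (∃ i, b = xv i) ∨ (∃ j, b = yv j) ∨ b = zv) :
    ∃ (d : ZMod 2) (t t' : L), t ∈ gr F L d ∧ t' ∈ gr F L d ∧ br F L t t' = zv ∧
      br F L t b = 0 ∧ br F L t' b = 0 := by
  have hX : ∀ r : ℕ, ∀ hr : r < m, br F L (xv ⟨r, by omega⟩) (xv ⟨r + m, by omega⟩) = zv := by
    intro r hr
    rw [hxx]; simp
  rcases hb with ⟨i, rfl⟩ | ⟨j, rfl⟩ | rfl
  · rcases Nat.eq_zero_or_pos n with hn | hn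
    · have : ∃ r, r < m ∧ r ≠ (i : ℕ) ∧ r + m ≠ (i : ℕ) := by
        by_cases h : (i : ℕ) = 0 ∨ (i : ℕ) = m
        · exact ⟨1, by omega, by omega, by omega⟩
        · exact ⟨0, by omega, by omega, by omega⟩
      obtain ⟨r, hr, h1, h2⟩ := this
      have hi := i.2
      refine ⟨0, _, _, hx _, hx _, hX r hr, ?_, ?_⟩
      · rw [hxx, if_neg, if_neg]
        · simp only; omega
        · simp only; omega
      · rw [hxx, if_neg, if_neg]
        · simp only; omega
        · simp only; omega
    · exact ⟨1, _, _, hy ⟨0, hn⟩, hy ⟨0, hn⟩, by rw [hyy]; simp, hyx _ _, hyx _ _⟩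
  · rcases Nat.eq_zero_or_pos m with hm | hm
    · have : ∃ k : Fin n, k ≠ j := by
        by_cases h : (j : ℕ) = 0
        · exact ⟨⟨1, by omega⟩, by intro h'; rw [← h'] at h; simp at h⟩
        · exact ⟨⟨0, by omega⟩, by intro h'; rw [← h'] at h; simp at h⟩
      obtain ⟨k, hk⟩ := this
      exact ⟨1, _, _, hy k, hy k, by rw [hyy]; simp, by rw [hyy, if_neg hk], by rw [hyy, if_neg hk]⟩
    · exact ⟨0, _, _, hx _, hx _, hX 0 hm, hxy _ _, hxy _ _⟩
  · rcases Nat.eq_zero_or_pos m with hm | hm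
    · exact ⟨1, _, _, hy ⟨0, by omega⟩, hy ⟨0, by omega⟩, by rw [hyy]; simp, hyz _, hyz _⟩
    · exact ⟨0, _, _, hx _, hx _, hX 0 hm, hxz _, hxz _⟩

set_option maxHeartbeats 2000000 in
theorem sh_main (F : Type u) [Field F] (h2 : (2 : F) ≠ 0)
    (m n : ℕ) (hmn : 2 ≤ m + n)
    (L : Type v) [AddCommGroup L] [Module F L] [SuperModule F L] [LieSuperAlgebra F L]
    (hL : IsHmn F m n L)
    (T : Type w) [AddCommGroup T] [Module F T] [SuperModule F T] [LieSuperAlgebra F T]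
    (p : TensorSqPairing F L T) (hT : IsTensorSquare F L T p) :
    ∃ e : T ≃ₗ[F] ShM F m n, (∀ a t, t ∈ gr F T a ↔ e t ∈ gr F (ShM F m n) a) ∧
      (∀ t, t ∈ squareBox F L T p ↔ e t ∈ shSS F m n) := by
  classical
  obtain ⟨xv, yv, zv, B, hBx, hBy, hBz, hx, hy, hz, hxx, hxy, hyx, hyy, hxz, hzx, hyz, hzy, hzz⟩ := hL
  have hBd : ∀ k, B k ∈ gr F L (shDeg' m n k) := by
    rintro (i | j | ⟨⟩)
    · rw [hBx]; exact hx i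
    · rw [hBy]; exact hy j
    · rw [hBz]; exact hz
  have hBc : ∀ k, (∃ i, B k = xv i) ∨ (∃ j, B k = yv j) ∨ B k = zv := by
    rintro (i | j | ⟨⟩)
    · exact Or.inl ⟨i, hBx i⟩
    · exact Or.inr (Or.inl ⟨j, hBy j⟩)
    · exact Or.inr (Or.inr hBz)
  have hE := fun k => sh_exists F hmn xv yv zv hx hy hxx hxy hyx hyy hxz hyz (B k) (hBc k)
  -- z pairs to zero
  have hpz1 : p.pair zv = 0 := by
    apply B.ext
    intro k
    obtain ⟨d, t, t', ht, ht', h1, h2, h3⟩ := hE k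
    have := p.rel1 d d t t' (B k) ht ht'
    rw [h1, h2, h3] at this
    simpa using this
  have hpz2 : p.pair.flip zv = 0 := by
    apply B.ext
    intro k
    obtain ⟨d, t, t', ht, ht', h1, h2, h3⟩ := hE k
    have := p.rel2 _ d d (B k) t t' (hBd k) ht ht'
    rw [h1, h2, h3] at this
    simpa using this
  -- brackets lie in span z
  have hbr : ∀ x y, br F L x y ∈ Submodule.span F {zv} := by
    have hz' : zv ∈ Submodule.span F {zv} := Submodule.mem_span_singleton_self zv
    have key : (br F L).compr₂ (Submodule.span F {zv}).mkQ = 0 := by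
      refine B.ext fun k => B.ext fun l => ?_
      simp only [LinearMap.compr₂_apply, LinearMap.zero_apply, Submodule.mkQ_apply,
        Submodule.Quotient.mk_eq_zero]
      rcases hBc k with ⟨i, h⟩ | ⟨i, h⟩ | h <;> rcases hBc l with ⟨j, h'⟩ | ⟨j, h'⟩ | h' <;>
        rw [h, h']
      · rw [hxx]
        split_ifs
        · exact hz'
        · exact Submodule.neg_mem _ hz'
        · exact Submodule.zero_mem _
      · rw [hxy]; exact Submodule.zero_mem _
      · rw [hxz]; exact Submodule.zero_mem _
      · rw [hyx]; exact Submodule.zero_mem _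
      · rw [hyy]
        split_ifs
        · exact hz'
        · exact Submodule.zero_mem _
      · rw [hyz]; exact Submodule.zero_mem _
      · rw [hzx]; exact Submodule.zero_mem _
      · rw [hzy]; exact Submodule.zero_mem _
      · rw [hzz]; exact Submodule.zero_mem _
    intro x y
    have := LinearMap.congr_fun (LinearMap.congr_fun key x) y
    simpa using this
  have hpb1 : ∀ x y t, p.pair (br F L x y) t = 0 := by
    intro x y t
    obtain ⟨c, hc⟩ := Submodule.mem_span_singleton.1 (hbr x y)
    rw [← hc, map_smul, hpz1]; simp
  have hzrepr : ∀ i : ShI m n, B.repr zv (shEmb m n i) = 0 := by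
    intro i
    rw [← hBz, B.repr_self]
    rcases i with i | i <;> simp [shEmb]
  have hbrepr : ∀ x y (i : ShI m n), B.repr (br F L x y) (shEmb m n i) = 0 := by
    intro x y i
    obtain ⟨c, hc⟩ := Submodule.mem_span_singleton.1 (hbr x y)
    rw [← hc]; simp [hzrepr]
  have hq1 : ∀ x y t, shPair B (br F L x y) t = 0 := by
    intro x y t; ext ⟨i, j⟩; simp [shPair_apply, hbrepr]
  have hq2 : ∀ x y t, shPair B t (br F L x y) = 0 := by
    intro x y t; ext ⟨i, j⟩; simp [shPair_apply, hbrepr]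
  have hhom := sh_homog B (shDeg' m n) hBd
  let q : TensorSqPairing F L (ShM F m n) :=
    { pair := shPair B
      pair_grade := by
        intro a b x y hx hy i j hij
        rw [shPair_apply]
        by_cases hi : shDeg m n i = a
        · by_cases hj : shDeg m n j = b
          · exact absurd (by rw [hi, hj]) hij
          · rw [hhom b y hy _ (by rw [shDeg'_emb]; exact hj), mul_zero]
        · rw [hhom a x hx _ (by rw [shDeg'_emb]; exact hi), zero_mul]
      rel1 := by intros; simp [hq1, hq2]
      rel2 := by intros; simp [hq1, hq2]
      rel3 := by intros; simp [hq1, sh_br_M] }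
  obtain ⟨h, hh, -⟩ := hT (ULift.{max v w} (ShM F m n)) (shLiftPair q)
  let h' : T →ₗ[F] ShM F m n :=
    (ULift.moduleEquiv (R := F) (M := ShM F m n)).toLinearMap.comp h.toLinearMap
  have hh' : ∀ x y, h' (p.pair x y) = shPair B x y := by
    intro x y
    change (h.toLinearMap (p.pair x y)).down = _
    rw [hh]; rfl
  have hh'g : ∀ a t, t ∈ gr F T a → h' t ∈ gr F (ShM F m n) a := h.map_grade
  have hh'b : ∀ s t, h' (br F T s t) = 0 := by
    intro s t
    change (h.toLinearMap (br F T s t)).down = _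
    rw [h.map_bracket]; rfl
  let b : ShI m n → L := fun i => B (shEmb m n i)
  have hbd : ∀ i, b i ∈ gr F L (shDeg m n i) := by
    intro i
    rw [← shDeg'_emb]; exact hBd _
  let g : ShM F m n →ₗ[F] T := Fintype.linearCombination F (fun ij => p.pair (b ij.1) (b ij.2))
  have hg : ∀ f, g f = ∑ ij, f ij • p.pair (b ij.1) (b ij.2) := fun f =>
    Fintype.linearCombination_apply F _ f
  have hgg : ∀ a f, f ∈ gr F (ShM F m n) a → g f ∈ gr F T a := by
    intro a f hf
    rw [hg]
    refine Submodule.sum_mem _ fun ij _ => ?_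
    by_cases hij : shDeg m n ij.1 + shDeg m n ij.2 = a
    · rw [← hij]
      exact Submodule.smul_mem _ _ (p.pair_grade _ _ _ _ (hbd _) (hbd _))
    · rw [hf ij.1 ij.2 hij, zero_smul]; exact Submodule.zero_mem _
  have hgb : ∀ f f', br F T (g f) (g f') = 0 := by
    intro f f'
    rw [hg, hg]
    simp only [map_sum, LinearMap.sum_apply, map_smul, LinearMap.smul_apply]
    refine Finset.sum_eq_zero fun ij _ => ?_
    rw [Finset.sum_eq_zero, smul_zero]
    intro kl _
    rw [p.rel3 _ _ _ _ _ _ (hbd _) (hbd _), hpb1]; simp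
  -- expansion of pair
  have hpx : ∀ x y, g (shPair B x y) = p.pair x y := by
    have : (shPair B).compr₂ g = p.pair := by
      refine B.ext fun k => B.ext fun l => ?_
      rw [LinearMap.compr₂_apply]
      have hk : (∃ i, k = shEmb m n i) ∨ B k = zv := by
        rcases k with i | j | ⟨⟩
        · exact Or.inl ⟨Sum.inl i, rfl⟩
        · exact Or.inl ⟨Sum.inr j, rfl⟩
        · exact Or.inr hBz
      have hl : (∃ i, l = shEmb m n i) ∨ B l = zv := by
        rcases l with i | j | ⟨⟩
        · exact Or.inl ⟨Sum.inl i, rfl⟩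
        · exact Or.inl ⟨Sum.inr j, rfl⟩
        · exact Or.inr hBz
      have hinj : Function.Injective (shEmb m n) := by
        rintro (i | i) (j | j) h <;> simp_all [shEmb]
      rcases hk with ⟨i, rfl⟩ | hk
      · rcases hl with ⟨j, rfl⟩ | hl
        · rw [hg, Finset.sum_eq_single (i, j)]
          · simp [shPair_apply, b]
          · rintro ⟨i', j'⟩ - hne
            rw [shPair_apply, B.repr_self, B.repr_self]
            have : ¬ (i = i' ∧ j = j') := by
              rintro ⟨rfl, rfl⟩; exact hne rfl
            rw [Finsupp.single_apply, Finsupp.single_apply]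
            by_cases hi : i = i'
            · have hj : j ≠ j' := fun hj => this ⟨hi, hj⟩
              simp [hinj.eq_iff, hj]
            · simp [hinj.eq_iff, hi]
          · simp
        · rw [hl]
          have e1 : shPair B (B (shEmb m n i)) zv = 0 := by
            ext ⟨a, c⟩; rw [shPair_apply, hzrepr]; simp
          have e2 := LinearMap.congr_fun hpz2 (B (shEmb m n i))
          rw [LinearMap.flip_apply] at e2
          rw [e1, e2]; simp
      · rw [hk]
        have e1 : shPair B zv (B l) = 0 := by
          ext ⟨a, c⟩; rw [shPair_apply, hzrepr]; simp
        rw [e1, hpz1]; simp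
    intro x y
    exact LinearMap.congr_fun (LinearMap.congr_fun this x) y
  -- g ∘ h' = id
  let k1 : LieSuperHom F T (ULift.{max u v} T) :=
    { toLinearMap := (ULift.moduleEquiv (R := F) (M := T)).symm.toLinearMap.comp (g.comp h')
      map_grade := by
        intro a t ht
        exact hgg a _ (hh'g a t ht)
      map_bracket := by
        intro s t
        apply ULift.ext
        change g (h' (br F T s t)) = br F T (g (h' s)) (g (h' t))
        rw [hh'b, hgb, map_zero] }
  let k2 : LieSuperHom F T (ULift.{max u v} T) :=
    { toLinearMap := (ULift.moduleEquiv (R := F) (M := T)).symm.toLinearMap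
      map_grade := by
        intro a t ht
        exact ht
      map_bracket := by
        intro s t
        rfl }
  have hk : k1 = k2 := by
    refine (hT (ULift.{max u v} T) (shLiftPair p)).unique ?_ ?_
    · intro x y
      apply ULift.ext
      change g (h' (p.pair x y)) = p.pair x y
      rw [hh', hpx]
    · intro x y; rfl
  have hgh : ∀ t, g (h' t) = t := by
    intro t
    have := congrArg (fun k : LieSuperHom F T (ULift.{max u v} T) => (k.toLinearMap t).down) hk
    exact this
  have hpe : ∀ i j, h' (p.pair (b i) (b j)) = Pi.single (i, j) 1 := by
    have hinj : Function.Injective (shEmb m n) := by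
      rintro (i | i) (j | j) h <;> simp_all [shEmb]
    intro i j
    rw [hh']
    ext ⟨i', j'⟩
    rw [shPair_apply, B.repr_self, B.repr_self, Finsupp.single_apply, Finsupp.single_apply,
      Pi.single_apply]
    rw [if_congr (hinj.eq_iff) rfl rfl, if_congr (hinj.eq_iff) rfl rfl,
      if_congr (Prod.mk.injEq _ _ _ _).to_iff rfl rfl]
    by_cases hi : i = i' <;> by_cases hj : j = j' <;> simp [hi, hj, eq_comm]
  have hhg : ∀ f, h' (g f) = f := by
    intro f
    rw [hg, map_sum]
    simp only [map_smul, hpe]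
    conv_rhs => rw [pi_eq_sum_univ' f]
  refine ⟨LinearEquiv.ofLinearMap h' g (LinearMap.ext hhg) (LinearMap.ext hgh), ?_, ?_⟩
  · intro a t
    refine ⟨hh'g a t, fun ht => ?_⟩
    have := hgg a _ ht
    rwa [LinearEquiv.coe_ofLinearMap, hgh] at this
  · intro t
    rw [LinearEquiv.coe_ofLinearMap]
    have hsym : ∀ (a c : ZMod 2) (x y : L), x ∈ gr F L a → y ∈ gr F L c →
        h' (p.pair x y + sgn F a c • p.pair y x) ∈ shSS F m n := by
      intro a c x y hx hy i j
      rw [map_add, map_smul, hh', hh']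
      simp only [Pi.add_apply, Pi.smul_apply, shPair_apply, smul_eq_mul]
      have X := fun i : ShI m n => hhom a x hx (shEmb m n i)
      have Y := fun i : ShI m n => hhom c y hy (shEmb m n i)
      simp only [shDeg'_emb] at X Y
      have P1 : B.repr x (shEmb m n i) * B.repr y (shEmb m n j) =
          sgn F (shDeg m n i) (shDeg m n j) * (sgn F a c *
            (B.repr y (shEmb m n j) * B.repr x (shEmb m n i))) := by
        by_cases hi : shDeg m n i = a
        · by_cases hj : shDeg m n j = c
          · rw [hi, hj]
            unfold sgn
            split_ifs <;> ring
          · rw [Y j hj]; ring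
        · rw [X i hi]; ring
      have P2 : sgn F a c * (B.repr y (shEmb m n i) * B.repr x (shEmb m n j)) =
          sgn F (shDeg m n i) (shDeg m n j) *
            (B.repr x (shEmb m n j) * B.repr y (shEmb m n i)) := by
        by_cases hi : shDeg m n i = c
        · by_cases hj : shDeg m n j = a
          · rw [hi, hj]
            rw [sh_sgn_comm F a c]; ring
          · rw [X j hj]; ring
        · rw [Y i hi]; ring
      rw [P1, P2]; ring
    constructor
    · intro ht
      have : squareBox F L T p ≤ (shSS F m n).comap h' := by
        refine Submodule.span_le.2 ?_
        rintro s (⟨a, c, x, y, hx, hy, rfl⟩ | ⟨x, hx, rfl⟩)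
        · exact hsym a c x y hx hy
        · have := hsym 0 0 x x hx hx
          have e : p.pair x x = (2 : F)⁻¹ • (p.pair x x + sgn F 0 0 • p.pair x x) := by
            simp only [sgn]
            rw [if_neg (by decide), one_smul, ← two_smul F, smul_smul, inv_mul_cancel₀ h2, one_smul]
          change h' (p.pair x x) ∈ shSS F m n
          rw [e, map_smul]
          exact Submodule.smul_mem _ _ this
      exact this ht
    · intro ht
      set f := h' t with hf
      have e1 : t = ∑ ij, f ij • p.pair (b ij.1) (b ij.2) := by
        rw [← hg, hf, hgh]
      have e2 : t = ∑ ij : ShI m n × ShI m n, f ij •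
          (sgn F (shDeg m n ij.1) (shDeg m n ij.2) • p.pair (b ij.2) (b ij.1)) := by
        rw [e1, ← (Equiv.prodComm (ShI m n) (ShI m n)).sum_comp]
        refine Finset.sum_congr rfl fun ij _ => ?_
        obtain ⟨i, j⟩ := ij
        simp only [Equiv.prodComm_apply, Prod.swap_prod_mk, smul_smul]
        rw [ht j i]
        congr 1
        rw [sh_sgn_comm F (shDeg m n j) (shDeg m n i)]; ring
      have e3 : t = (2 : F)⁻¹ • ∑ ij : ShI m n × ShI m n, f ij •
          (p.pair (b ij.1) (b ij.2) +
            sgn F (shDeg m n ij.1) (shDeg m n ij.2) • p.pair (b ij.2) (b ij.1)) := by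
        simp only [smul_add, Finset.sum_add_distrib]
        rw [← e1, ← e2, ← smul_add, ← two_smul F, smul_smul, inv_mul_cancel₀ h2, one_smul]
      rw [e3]
      refine Submodule.smul_mem _ _ (Submodule.sum_mem _ fun ij _ => Submodule.smul_mem _ _ ?_)
      exact Submodule.subset_span (Or.inl ⟨_, _, _, _, hbd _, hbd _, rfl⟩)

theorem sh_transfer {F : Type u} [Field F] {V : Type v} {W : Type w} [AddCommGroup V] [Module F V]
    [AddCommGroup W] [Module F W] (e : V ≃ₗ[F] W) (A : Submodule F V) (C : Submodule F W)
    (h : ∀ t, t ∈ A ↔ e t ∈ C) : finrank F A = finrank F C := by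
  have : A.map e.toLinearMap = C := by
    ext s
    rw [Submodule.mem_map]
    constructor
    · rintro ⟨t, ht, rfl⟩; exact (h t).1 ht
    · intro hs
      exact ⟨e.symm s, (h _).2 (by simpa using hs), by simp⟩
  rw [← this]
  exact (e.submoduleMap A).finrank_eq

theorem stmt_18 (F : Type*) [Field F] (hchar2 : ringChar F ≠ 2) (hchar3 : ringChar F ≠ 3)
    (m n : ℕ) (hmn : 2 ≤ m + n)
    (L : Type*) [AddCommGroup L] [Module F L] [SuperModule F L] [LieSuperAlgebra F L] (hL : IsHmn F m n L)
    (T : Type*) [AddCommGroup T] [Module F T] [SuperModule F T] [LieSuperAlgebra F T]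
    (p : TensorSqPairing F L T) (hT : IsTensorSquare F L T p) :
    finrank F (gr F T 0) = 4 * m ^ 2 + n ^ 2 ∧
    finrank F (gr F T 1) = 4 * m * n ∧
    finrank F T = (2 * m + n) ^ 2 ∧
    finrank F (squareBox F L T p ⊓ gr F T 0 : Submodule F T)
      = 2 * m ^ 2 + m + n * (n - 1) / 2 ∧
    finrank F (squareBox F L T p ⊓ gr F T 1 : Submodule F T) = 2 * m * n := by
  have h2 : (2 : F) ≠ 0 := Ring.two_ne_zero hchar2
  obtain ⟨e, he, hb⟩ := sh_main F h2 m n hmn L hL T p hT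
  refine ⟨?_, ?_, ?_, ?_, ?_⟩
  · rw [sh_transfer e _ _ (he 0), sh_rank0]
  · rw [sh_transfer e _ _ (he 1), sh_rank1]
  · rw [e.finrank_eq, Module.finrank_fintype_fun_eq_card]
    simp only [Fintype.card_prod, Fintype.card_sum, Fintype.card_fin]
    ring
  · rw [sh_transfer e _ (shSS F m n ⊓ gr F (ShM F m n) 0)
      (fun t => and_congr (hb t) (he 0 t)), sh_box0 F h2]
  · rw [sh_transfer e _ (shSS F m n ⊓ gr F (ShM F m n) 1)
      (fun t => and_congr (hb t) (he 1 t)), sh_box1 F]
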